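/- arXiv:2006.16237 — 7 statements merged into one kernel-verified Lean document; each statement's English description precedes it below -/
import Mathlib

section
/- Let α, β, γ be positive irrational numbers with α + β + γ = 1, β < 1/2 and α < γ. Then there exists a partition of ℕ into three sets A, B, C such that: A = W_α; B is the range of a strictly increasing sequence (b̃(n)) with |b̃(n) − b(n)| ≤ 1 for all n ∈ ℕ, where b(n) = ⌈(n − 1/2)/β⌉ is the n-th term of W_β; and C is the range of a strictly increasing sequence (c̃(n)) with |c̃(n) − c(n)| ≤ 1 for all n ∈ ℕ, where c(n) = ⌈(n − 1/2)/γ⌉ is the n-th term of W_γ. -/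
/-- The `n`-th term of the Webster sequence of density `d`: `⌈(n - 1/2)/d⌉`. -/
noncomputable def wTerm (d : ℝ) (n : ℕ) : ℕ := ⌈((n : ℝ) - 1/2) / d⌉₊

/-- The Webster sequence of density `d`, as a set of positive integers. -/
def wSet (d : ℝ) : Set ℕ := {m : ℕ | ∃ n : ℕ, 1 ≤ n ∧ m = wTerm d n}

/-- The number of terms of the Webster sequence of density `d` that are at most `x`. -/
noncomputable def websterCount (d : ℝ) (x : ℤ) : ℤ := ⌊d * x + 1/2⌋

theorem websterCount_le (d : ℝ) (x : ℤ) : (websterCount d x : ℝ) ≤ d * x + 1/2 :=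
  Int.floor_le _

theorem lt_websterCount (d : ℝ) (x : ℤ) : d * x - 1/2 < websterCount d x := by
  have := Int.lt_floor_add_one (d * x + 1/2)
  unfold websterCount
  linarith

theorem websterCount_zero (d : ℝ) : websterCount d 0 = 0 := by
  simp only [websterCount, Int.floor_eq_zero_iff]
  norm_num

theorem websterCount_mono {d : ℝ} (hd : 0 ≤ d) : Monotone (websterCount d) := by
  intro x y h
  have h' : (x : ℝ) ≤ y := by exact_mod_cast h
  unfold websterCount
  gcongr

theorem websterCount_succ {d : ℝ} (h0 : 0 < d) (h1 : d < 1) (x : ℤ) :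
    websterCount d (x + 1) = websterCount d x ∨
      websterCount d (x + 1) = websterCount d x + 1 := by
  have hm := websterCount_mono h0.le (show x ≤ x + 1 by omega)
  have h2 := websterCount_le d (x + 1)
  have h3 := lt_websterCount d x
  push_cast at h2
  have : websterCount d (x + 1) < websterCount d x + 2 := by
    have : (websterCount d (x + 1) : ℝ) < websterCount d x + 2 := by linarith
    exact_mod_cast this
  omega

theorem exists_le_websterCount {d : ℝ} (hd : 0 < d) (k : ℤ) :
    ∃ N : ℕ, k ≤ websterCount d N := by
  obtain ⟨N, hN⟩ := exists_nat_gt ((k + 1) / d)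
  rw [div_lt_iff₀ hd] at hN
  refine ⟨N, ?_⟩
  have h := lt_websterCount d N
  push_cast at h
  have : (k : ℝ) < websterCount d N := by linarith
  exact_mod_cast this.le

theorem wTerm_le_iff {d : ℝ} (hd : 0 < d) (n N : ℕ) :
    wTerm d n ≤ N ↔ (n : ℤ) ≤ websterCount d N := by
  rw [wTerm, Nat.ceil_le, div_le_iff₀ hd, websterCount, Int.le_floor]
  push_cast
  constructor <;> intro h <;> linarith

/-- If `t n ≤ N ↔ n ≤ F N` for a counting function `F` with steps `0` and `1`, then `t`
enumerates the jumps of `F` increasingly. -/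
theorem enumerates_jumps {F : ℕ → ℤ} {t : ℕ → ℕ} (h0 : F 0 = 0)
    (hstep : ∀ N, F (N + 1) = F N ∨ F (N + 1) = F N + 1)
    (ht : ∀ n N : ℕ, 1 ≤ n → (t n ≤ N ↔ (n : ℤ) ≤ F N)) :
    StrictMonoOn t {n : ℕ | 1 ≤ n} ∧
      t '' {n : ℕ | 1 ≤ n} = {m | ∃ k, m = k + 1 ∧ F (k + 1) = F k + 1} := by
  have hnonneg : ∀ N, 0 ≤ F N := by
    intro N
    induction N with
    | zero => omega
    | succ k ih => have := hstep k; omega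
  have hval : ∀ n, 1 ≤ n → ∃ k, t n = k + 1 ∧ F k + 1 = n ∧ F (k + 1) = n := by
    intro n hn
    have h1 := (ht n (t n) hn).1 le_rfl
    rcases h : t n with _ | k
    · rw [h] at h1; omega
    · rw [h] at h1
      have h2 := (ht n k hn).not.1 (by omega)
      have := hstep k
      exact ⟨k, rfl, by omega, by omega⟩
  refine ⟨?_, ?_⟩
  · intro a ha b hb hab
    obtain ⟨k, hk, hk1, -⟩ := hval b hb
    have := (ht a k ha).2 (by omega)
    omega
  · ext m
    constructor
    · rintro ⟨n, hn, rfl⟩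
      obtain ⟨k, hk, hk1, hk2⟩ := hval n hn
      exact ⟨k, hk, by omega⟩
    · rintro ⟨k, rfl, hk⟩
      have hk0 := hnonneg k
      obtain ⟨n, hn⟩ := Int.eq_ofNat_of_zero_le (hnonneg (k + 1))
      have hn1 : 1 ≤ n := by omega
      refine ⟨n, hn1, ?_⟩
      have h1 := (ht n (k + 1) hn1).2 (by omega)
      have h2 := (ht n k hn1).not.2 (by omega)
      omega

/-- A nondecreasing lattice path between the barriers `L` and `U` that moves only when `R` does
exists as soon as no two barrier points obstruct each other. -/
theorem exists_lattice_path {L U R : ℕ → ℤ}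
    (hR : ∀ N, R (N + 1) = R N ∨ R (N + 1) = R N + 1)
    (hLU : ∀ M N, M ≤ N → L M ≤ U N)
    (hULR : ∀ M N, M ≤ N → L N ≤ U M + (R N - R M))
    (hL0 : ∀ N, L N ≤ R N - R 0) (hU0 : ∀ N, 0 ≤ U N) :
    ∃ F : ℕ → ℤ, F 0 = 0 ∧
      (∀ N, F (N + 1) = F N ∨ F (N + 1) = F N + 1 ∧ R (N + 1) = R N + 1) ∧
      ∀ N, L N ≤ F N ∧ F N ≤ U N := by
  have hRmono : Monotone R := monotone_nat_of_le_succ fun N => by have := hR N; omega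
  let Good (N : ℕ) (b : ℤ) : Prop := ∀ M, N ≤ M → L M ≤ b + (R M - R N) ∧ b ≤ U M
  have hnext : ∀ (N : ℕ) (b : ℤ), Good N b →
      ∃ b', Good (N + 1) b' ∧ (b' = b ∨ b' = b + 1 ∧ R (N + 1) = R N + 1) := by
    intro N b hb
    rcases hR N with h | h
    · refine ⟨b, fun M hM => ?_, Or.inl rfl⟩
      have := hb M (by omega)
      omega
    · by_cases hstay : Good (N + 1) b
      · exact ⟨b, hstay, Or.inl rfl⟩
      · refine ⟨b + 1, fun M' hM' => ?_, Or.inr ⟨rfl, h⟩⟩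
        have hb' := hb M' (by omega)
        refine ⟨by omega, ?_⟩
        by_contra hcon
        simp only [Good, not_forall] at hstay
        obtain ⟨M, hM, hbad⟩ := hstay
        have hbM := hb M (by omega)
        have hRM := hRmono hM
        have hRM' := hRmono hM'
        rcases le_total M M' with hle | hle
        · have := hLU M M' hle
          omega
        · have := hULR M' M hle
          omega
  choose! next hnext_good hnext_step using hnext
  let F : ℕ → ℤ := fun N => Nat.rec 0 next N
  have hgood : ∀ N, Good N (F N) := by
    intro N
    induction N with
    | zero => exact fun M _ => ⟨by have := hL0 M; change L M ≤ 0 + (R M - R 0); omega, hU0 M⟩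
    | succ k ih => exact hnext_good k _ ih
  refine ⟨F, rfl, fun N => hnext_step N _ (hgood N), fun N => ?_⟩
  have := hgood N N le_rfl
  omega

/-- A counting function squeezed between shifts of `websterCount d` belongs to an almost Webster
sequence. -/
theorem exists_almost_webster {d : ℝ} (hd : 0 < d) {F : ℕ → ℤ} (h0 : F 0 = 0)
    (hstep : ∀ N, F (N + 1) = F N ∨ F (N + 1) = F N + 1)
    (hlow : ∀ N : ℕ, websterCount d ((N : ℤ) - 1) ≤ F N)
    (hupp : ∀ N : ℕ, F N ≤ websterCount d ((N : ℤ) + 1)) :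
    ∃ t : ℕ → ℕ, StrictMonoOn t {n : ℕ | 1 ≤ n} ∧
      {m | ∃ k, m = k + 1 ∧ F (k + 1) = F k + 1} = t '' {n : ℕ | 1 ≤ n} ∧
      ∀ n : ℕ, 1 ≤ n → |(t n : ℤ) - (wTerm d n : ℤ)| ≤ 1 := by
  have hlow' : ∀ N : ℕ, websterCount d N ≤ F (N + 1) := by
    intro N
    have := hlow (N + 1)
    simpa using this
  have hmono : Monotone F := monotone_nat_of_le_succ fun N => by have := hstep N; omega
  have hex : ∀ n : ℕ, ∃ N, (n : ℤ) ≤ F N := by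
    intro n
    obtain ⟨N, hN⟩ := exists_le_websterCount hd n
    exact ⟨N + 1, hN.trans (hlow' N)⟩
  classical
  let t : ℕ → ℕ := fun n => Nat.find (hex n)
  have ht : ∀ n N : ℕ, t n ≤ N ↔ (n : ℤ) ≤ F N := fun n N =>
    ⟨fun h => (Nat.find_spec (hex n)).trans (hmono h), fun h => Nat.find_min' (hex n) h⟩
  obtain ⟨hs, himage⟩ := enumerates_jumps h0 hstep fun n N _ => ht n N
  refine ⟨t, hs, himage.symm, fun n _ => ?_⟩
  have h1 : t n ≤ wTerm d n + 1 :=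
    (ht _ _).2 (((wTerm_le_iff hd n _).1 le_rfl).trans (hlow' _))
  have h2 : wTerm d n ≤ t n + 1 := by
    rw [wTerm_le_iff hd]
    push_cast
    exact ((ht _ _).1 le_rfl).trans (hupp _)
  rw [abs_le]
  omega

/-- The window `(M, N]`, shortened by one at each end, contains at most as many terms of the Webster
sequence of density `d` as the full window has integers outside that of density `a`. -/
theorem websterCount_window {a d : ℝ} (ha : 0 < a) (ha1 : a < 1) (hd : 0 < d) (had : a + d < 1)
    (h : 3 * a + d < 2) {M N : ℤ} (hMN : M ≤ N) :
    websterCount d (N - 1) - websterCount d (M + 1) ≤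
      (N - websterCount a N) - (M - websterCount a M) := by
  by_cases hlt : N ≤ M + 2
  · have h1 := websterCount_mono hd.le (show N - 1 ≤ M + 1 by omega)
    have h2 : websterCount a N - websterCount a M < N - M + 1 := by
      have h3 := websterCount_le a N
      have h4 := lt_websterCount a M
      have h5 : (M : ℝ) ≤ N := by exact_mod_cast hMN
      have : (websterCount a N - websterCount a M : ℝ) < N - M + 1 := by nlinarith
      exact_mod_cast this
    omega
  · have h1 := websterCount_le d (N - 1)
    have h2 := lt_websterCount d (M + 1)
    have h3 := websterCount_le a N
    have h4 := lt_websterCount a M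
    have h5 : (M : ℝ) + 3 ≤ N := by exact_mod_cast (show M + 3 ≤ N by omega)
    push_cast at h1 h2
    have : ((websterCount d (N - 1) - websterCount d (M + 1) : ℤ) : ℝ) <
        (((N - websterCount a N) - (M - websterCount a M) + 1 : ℤ) : ℝ) := by
      push_cast
      nlinarith [mul_nonneg (sub_nonneg.2 had.le) (sub_nonneg.2 h5)]
    have := Int.cast_lt.1 this
    omega

theorem websterCount_add_le {a b c : ℝ} (hsum : a + b + c = 1)
    (ha : a < 1/2) {N : ℤ} :
    websterCount b (N - 1) + websterCount c (N - 1) ≤ N - websterCount a N := by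
  have h1 := websterCount_le b (N - 1)
  have h2 := websterCount_le c (N - 1)
  have h3 := websterCount_le a N
  push_cast at h1 h2
  have : ((websterCount b (N - 1) + websterCount c (N - 1) : ℤ) : ℝ) <
      ((N - websterCount a N + 1 : ℤ) : ℝ) := by
    push_cast
    obtain rfl : a = 1 - b - c := by linarith
    nlinarith
  have := Int.cast_lt.1 this
  omega

theorem le_websterCount_add {a b c : ℝ} (hsum : a + b + c = 1) (ha : a < 1/2) {N : ℤ} :
    N - websterCount a N ≤ websterCount b (N + 1) + websterCount c (N + 1) := by
  have h1 := lt_websterCount b (N + 1)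
  have h2 := lt_websterCount c (N + 1)
  have h3 := lt_websterCount a N
  push_cast at h1 h2
  have : ((N - websterCount a N : ℤ) : ℝ) <
      ((websterCount b (N + 1) + websterCount c (N + 1) + 1 : ℤ) : ℝ) := by
    push_cast
    obtain rfl : a = 1 - b - c := by linarith
    nlinarith
  have := Int.cast_lt.1 this
  omega

/-- Partition of the positive integers into the exact Webster sequence `W_α`
and two almost Webster sequences of densities `β` and `γ`. -/
theorem webster_three_part_partition (α β γ : ℝ)
    (hα : 0 < α) (hβ : 0 < β) (hγ : 0 < γ)
    (hαi : Irrational α) (hβi : Irrational β) (hγi : Irrational γ)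
    (hsum : α + β + γ = 1) (hβhalf : β < 1/2) (hαγ : α < γ) :
    ∃ (B C : Set ℕ) (bt ct : ℕ → ℕ),
      wSet α ∪ B ∪ C = {n : ℕ | 1 ≤ n} ∧
      Disjoint (wSet α) B ∧ Disjoint (wSet α) C ∧ Disjoint B C ∧
      StrictMonoOn bt {n : ℕ | 1 ≤ n} ∧ B = bt '' {n : ℕ | 1 ≤ n} ∧
      (∀ n : ℕ, 1 ≤ n → |(bt n : ℤ) - (wTerm β n : ℤ)| ≤ 1) ∧
      StrictMonoOn ct {n : ℕ | 1 ≤ n} ∧ C = ct '' {n : ℕ | 1 ≤ n} ∧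
      (∀ n : ℕ, 1 ≤ n → |(ct n : ℤ) - (wTerm γ n : ℤ)| ≤ 1) := by
  have hα1 : α < 1/2 := by linarith
  let R : ℕ → ℤ := fun N => N - websterCount α N
  have hαstep : ∀ N : ℕ, websterCount α ((N + 1 : ℕ) : ℤ) = websterCount α N ∨
      websterCount α ((N + 1 : ℕ) : ℤ) = websterCount α N + 1 := by
    intro N
    have := websterCount_succ hα (by linarith) (N : ℤ)
    simpa using this
  have hR0 : R 0 = 0 := by simp [R, websterCount_zero]
  have hR : ∀ N, R (N + 1) = R N ∨ R (N + 1) = R N + 1 := by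
    intro N
    have := hαstep N
    simp only [R]
    omega
  have hRmono : Monotone R := monotone_nat_of_le_succ fun N => by have := hR N; omega
  have hβmono := websterCount_mono hβ.le
  have hγmono := websterCount_mono hγ.le
  have hlow : ∀ N : ℕ, websterCount β ((N : ℤ) - 1) + websterCount γ ((N : ℤ) - 1) ≤ R N :=
    fun N => websterCount_add_le hsum hα1
  have hupp : ∀ N : ℕ, R N ≤ websterCount β ((N : ℤ) + 1) + websterCount γ ((N : ℤ) + 1) :=
    fun N => le_websterCount_add hsum hα1
  have hβwin : ∀ M N : ℕ, M ≤ N →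
      websterCount β ((N : ℤ) - 1) - websterCount β ((M : ℤ) + 1) ≤ R N - R M :=
    fun M N h => websterCount_window hα (by linarith) hβ (by linarith) (by linarith)
      (by exact_mod_cast h)
  have hγwin : ∀ M N : ℕ, M ≤ N →
      websterCount γ ((N : ℤ) - 1) - websterCount γ ((M : ℤ) + 1) ≤ R N - R M :=
    fun M N h => websterCount_window hα (by linarith) hγ (by linarith) (by linarith)
      (by exact_mod_cast h)
  have hβnonneg : ∀ N : ℕ, 0 ≤ websterCount β ((N : ℤ) + 1) := fun N =>
    (websterCount_zero β).symm.le.trans (hβmono (by omega))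
  have hγnonneg : ∀ N : ℕ, 0 ≤ websterCount γ ((N : ℤ) + 1) := fun N =>
    (websterCount_zero γ).symm.le.trans (hγmono (by omega))
  have hRnonneg : ∀ N, 0 ≤ R N := fun N => hR0.symm.le.trans (hRmono (Nat.zero_le N))
  have hpred : ∀ N : ℕ, websterCount β ((N : ℤ) - 1) ≤ R N ∧
      websterCount γ ((N : ℤ) - 1) ≤ R N := by
    intro N
    have := hlow N
    have := hRnonneg N
    rcases Nat.eq_zero_or_pos N with rfl | hN
    · have h1 := hβmono (show (((0 : ℕ) : ℤ) - 1) ≤ 0 by omega)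
      have h2 := hγmono (show (((0 : ℕ) : ℤ) - 1) ≤ 0 by omega)
      rw [websterCount_zero] at h1 h2
      omega
    · have h1 := hβmono (show 0 ≤ (N : ℤ) - 1 by omega)
      have h2 := hγmono (show 0 ≤ (N : ℤ) - 1 by omega)
      rw [websterCount_zero] at h1 h2
      omega
  obtain ⟨F, hF0, hFstep, hFbd⟩ := exists_lattice_path
    (L := fun N => max (websterCount β ((N : ℤ) - 1)) (R N - websterCount γ ((N : ℤ) + 1)))
    (U := fun N => min (websterCount β ((N : ℤ) + 1)) (R N - websterCount γ ((N : ℤ) - 1)))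
    hR
    (by
      intro M N h
      have h1 := hβmono (show (M : ℤ) - 1 ≤ N + 1 by omega)
      have h2 := hβmono (show (M : ℤ) - 1 ≤ N - 1 by omega)
      have h3 := hβmono (show (M : ℤ) + 1 ≤ N + 1 by omega)
      have := hlow N
      have := hupp M
      have := hγwin M N h
      simp only [max_le_iff, le_min_iff]
      omega)
    (by
      intro M N h
      have h1 := hγmono (show (M : ℤ) - 1 ≤ N + 1 by omega)
      have h2 := hγmono (show (M : ℤ) - 1 ≤ N - 1 by omega)
      have h3 := hγmono (show (M : ℤ) + 1 ≤ N + 1 by omega)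
      have := hlow N
      have := hupp M
      have := hβwin M N h
      rw [max_le_iff, min_add, le_min_iff, le_min_iff]
      omega)
    (by
      intro N
      have := (hpred N).1
      have := hγnonneg N
      rw [max_le_iff]
      omega)
    (by
      intro N
      have := (hpred N).2
      have := hβnonneg N
      rw [le_min_iff]
      omega)
  simp only [max_le_iff, le_min_iff] at hFbd
  have hGstep : ∀ N, R (N + 1) - F (N + 1) = R N - F N ∨
      R (N + 1) - F (N + 1) = R N - F N + 1 := by
    intro N
    have := hFstep N
    have := hR N
    omega
  obtain ⟨bt, hbmono, hbimage, hbclose⟩ := exists_almost_webster hβ hF0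
    (fun N => (hFstep N).imp id And.left) (fun N => (hFbd N).1.1) (fun N => (hFbd N).2.1)
  obtain ⟨ct, hcmono, hcimage, hcclose⟩ := exists_almost_webster hγ
    (F := fun N => R N - F N) (by simp only [hR0, hF0, sub_zero]) hGstep
    (fun N => by have := (hFbd N).2.2; omega) (fun N => by have := (hFbd N).1.2; omega)
  have hA : wSet α = {m | ∃ k : ℕ, m = k + 1 ∧
      websterCount α ((k + 1 : ℕ) : ℤ) = websterCount α (k : ℤ) + 1} := by
    rw [← (enumerates_jumps (F := fun N : ℕ => websterCount α N) (websterCount_zero α) hαstep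
      fun n N _ => wTerm_le_iff hα n N).2]
    ext m
    simp only [wSet, Set.mem_ofPred_eq, Set.mem_image, eq_comm]
  refine ⟨_, _, bt, ct, ?_, ?_, ?_, ?_, hbmono, hbimage, hbclose, hcmono, hcimage, hcclose⟩
  · ext m
    simp only [hA, Set.mem_union, Set.mem_ofPred_eq]
    constructor
    · rintro ((⟨k, rfl, -⟩ | ⟨k, rfl, -⟩) | ⟨k, rfl, -⟩) <;> omega
    · intro hm
      obtain ⟨k, rfl⟩ := Nat.exists_eq_add_of_le' hm
      have h1 := hαstep k
      have h2 := hFstep k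
      have h3 : R (k + 1) = ((k + 1 : ℕ) : ℤ) - websterCount α ((k + 1 : ℕ) : ℤ) := rfl
      have h4 : R k = k - websterCount α k := rfl
      rcases h1 with h1 | h1
      · rcases h2 with h2 | h2
        · exact Or.inr ⟨k, rfl, by omega⟩
        · exact Or.inl (Or.inr ⟨k, rfl, h2.1⟩)
      · exact Or.inl (Or.inl ⟨k, rfl, h1⟩)
  all_goals
    try rw [hA]
    rw [Set.disjoint_left]
    rintro _ ⟨k, rfl, h⟩ ⟨k', hk, h'⟩
    obtain rfl : k = k' := by omega
    have h2 := hFstep k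
    have h3 : R (k + 1) = ((k + 1 : ℕ) : ℤ) - websterCount α ((k + 1 : ℕ) : ℤ) := rfl
    have h4 : R k = k - websterCount α k := rfl
    omega
end

section
/- Let α, β, γ be positive irrational numbers with α + β + γ = 1, β < 1/2 and α < γ. Then there exist pairwise disjoint sets A, B, C ⊆ ℕ with A ∪ B ∪ C = ℕ such that for every n ∈ ℕ, A(n) ∈ {⌊nα⌋, ⌈nα⌉}, B(n) ∈ {⌊nβ⌋, ⌈nβ⌉}, and C(n) ∈ {⌊nγ⌋, ⌈nγ⌉}, where S(n) = #{k ∈ S : k ≤ n} denotes the counting function of a set S ⊆ ℕ. -/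
/-- Counting function of a set of positive integers: `S(m) = #{k ∈ S : k ≤ m}`. -/
noncomputable def wCount (S : Set ℕ) (m : ℕ) : ℕ := (S ∩ Set.Iic m).ncard

/-- Greedy apportionment: among the indices that may receive a seat without exceeding their upper
quota, one with the earliest deadline `(s n j + 1) / w j` receives it. -/
theorem exists_greedy_apportionment {ι : Type*} [Fintype ι] [DecidableEq ι] (w : ι → ℝ)
    (hsum : ∑ i, w i = 1) :
    ∃ (s : ℕ → ι → ℕ) (c : ℕ → ι), (∀ i, s 0 i = 0) ∧ (∀ n, ∑ i, s n i = n) ∧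
      (∀ n i, s (n + 1) i = s n i + if c n = i then 1 else 0) ∧
      (∀ n, (s n (c n) : ℝ) < (n + 1) * w (c n)) ∧
      ∀ n j, (s n j : ℝ) < (n + 1) * w j →
        ((s n (c n) : ℝ) + 1) / w (c n) ≤ ((s n j : ℝ) + 1) / w j := by
  have key : ∀ (v : ι → ℕ) (n : ℕ), ∃ i, ∑ i, v i = n →
      (v i : ℝ) < (n + 1) * w i ∧ ∀ j, (v j : ℝ) < (n + 1) * w j →
        ((v i : ℝ) + 1) / w i ≤ ((v j : ℝ) + 1) / w j := by
    intro v n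
    by_cases hv : ∑ i, v i = n
    · have hne : ∃ i, (v i : ℝ) < (n + 1) * w i := by
        by_contra! h
        have h1 := Finset.sum_le_sum fun i (_ : i ∈ Finset.univ) => h i
        rw [← Finset.mul_sum, hsum, ← Nat.cast_sum, hv] at h1
        linarith
      obtain ⟨i, hi, hmin⟩ := Set.exists_min_image {i | (v i : ℝ) < (n + 1) * w i}
        (fun i => ((v i : ℝ) + 1) / w i) (Set.toFinite _) hne
      exact ⟨i, fun _ => ⟨hi, hmin⟩⟩
    · have : Nonempty ι := by
        by_contra h
        rw [not_nonempty_iff] at h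
        simp at hsum
      exact ⟨Classical.arbitrary ι, fun h => absurd h hv⟩
  choose f hf using key
  let s : ℕ → ι → ℕ := fun n => Nat.rec (fun _ => 0)
    (fun n v i => v i + if f v n = i then 1 else 0) n
  have hs : ∀ n, ∑ i, s n i = n := by
    intro n
    induction n with
    | zero => simp [s]
    | succ n ih =>
      change ∑ i, (s n i + if f (s n) n = i then 1 else 0) = n + 1
      rw [Finset.sum_add_distrib, ih]
      simp
  exact ⟨s, fun n => f (s n) n, fun _ => rfl, hs, fun _ _ => rfl,
    fun n => (hf _ n (hs n)).1, fun n => (hf _ n (hs n)).2⟩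

/-- The greedy apportionment stays within one seat of its exact share. -/
theorem exists_quota_apportionment {ι : Type*} [Fintype ι] [DecidableEq ι] (w : ι → ℝ)
    (hw : ∀ i, 0 < w i) (hsum : ∑ i, w i = 1) :
    ∃ (s : ℕ → ι → ℕ) (c : ℕ → ι), (∀ i, s 0 i = 0) ∧
      (∀ n i, s (n + 1) i = s n i + if c n = i then 1 else 0) ∧
      ∀ n i, (s n i : ℝ) < n * w i + 1 ∧ n * w i < (s n i : ℝ) + 1 := by
  obtain ⟨s, c, h0, hs, hstep, helig, hmin⟩ := exists_greedy_apportionment w hsum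
  refine ⟨s, c, h0, hstep, fun n i => ⟨?_, ?_⟩⟩
  · induction n with
    | zero => simp [h0]
    | succ n ih =>
      rw [hstep]
      have := hw i
      split_ifs with h
      · subst h
        have := helig n
        push_cast
        linarith
      · push_cast
        linarith
  · by_contra! hlow
    have key : ∀ q, ∃ p ≤ q, ∀ k, s p k ≤ s q k ∧
        (s q k = s p k ∨ (s q k : ℝ) ≤ n * w k) ∧
        (n * w k < (s p k : ℝ) + 1 ∨ p * w k ≤ (s p k : ℝ)) := by
      intro q
      induction q with
      | zero => exact ⟨0, le_rfl, fun k => by simp [h0]⟩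
      | succ q ih =>
        by_cases hlate : n * w (c q) < (s q (c q) : ℝ) + 1
        · refine ⟨q + 1, le_rfl, fun k => ⟨le_rfl, Or.inl rfl, ?_⟩⟩
          have hk : (s q k : ℝ) ≤ s (q + 1) k := by
            rw [hstep]
            push_cast
            split_ifs <;> simp
          by_cases he : (s q k : ℝ) < (q + 1) * w k
          · left
            have h1 : (n : ℝ) < ((s q k : ℝ) + 1) / w k :=
              ((lt_div_iff₀ (hw _)).2 hlate).trans_le (hmin q k he)
            rw [lt_div_iff₀ (hw k)] at h1
            linarith
          · right
            push_cast
            linarith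
        · obtain ⟨p, hp, h⟩ := ih
          refine ⟨p, hp.trans q.le_succ, fun k => ?_⟩
          obtain ⟨h1, h2, h3⟩ := h k
          rw [hstep]
          split_ifs with hc
          · subst hc
            refine ⟨by omega, Or.inr ?_, h3⟩
            push_cast
            linarith
          · exact ⟨h1, h2, h3⟩
    obtain ⟨p, hp, h⟩ := key n
    have hpn : (p : ℝ) ≤ n := by exact_mod_cast hp
    have hle : ∀ k, (s n k : ℝ) - s p k ≤ (n - p) * w k := by
      intro k
      obtain ⟨-, h2, h3⟩ := h k
      have hnn : 0 ≤ ((n : ℝ) - p) * w k := mul_nonneg (by linarith) (hw k).le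
      rcases h2 with h2 | h2
      · rw [h2]
        linarith
      rcases h3 with h3 | h3
      · have : s n k < s p k + 1 := by exact_mod_cast h2.trans_lt h3
        have : (s n k : ℝ) ≤ s p k := by exact_mod_cast Nat.lt_succ_iff.1 this
        linarith
      · linarith
    have hlt : (s n i : ℝ) - s p i < (n - p) * w i := by
      obtain ⟨h1, -, h3⟩ := h i
      have h1 : (s p i : ℝ) ≤ s n i := by exact_mod_cast h1
      rcases h3 with h3 | h3 <;> linarith
    have := Finset.sum_lt_sum (fun k (_ : k ∈ Finset.univ) => hle k) ⟨i, Finset.mem_univ i, hlt⟩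
    rw [← Finset.mul_sum, hsum, Finset.sum_sub_distrib, ← Nat.cast_sum, ← Nat.cast_sum, hs, hs]
      at this
    linarith

theorem wCount_zero_of_zero_notMem {S : Set ℕ} (h : 0 ∉ S) : wCount S 0 = 0 := by
  have : S ∩ Set.Iic 0 = ∅ := by
    ext k
    simp only [Set.mem_inter_iff, Set.mem_Iic, Set.mem_empty_iff_false, iff_false]
    rintro ⟨hk, hk0⟩
    exact h (Nat.le_zero.1 hk0 ▸ hk)
  simp [wCount, this]

open Classical in
theorem wCount_succ (S : Set ℕ) (n : ℕ) :
    wCount S (n + 1) = wCount S n + if n + 1 ∈ S then 1 else 0 := by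
  have hI : Set.Iic (n + 1) = insert (n + 1) (Set.Iic n) := by
    ext k
    simp only [Set.mem_Iic, Set.mem_insert_iff]
    omega
  unfold wCount
  split_ifs with h
  · rw [hI, Set.inter_insert_of_mem h, Set.ncard_insert_of_notMem (by simp)
      ((Set.finite_Iic n).inter_of_right S)]
  · rw [hI, Set.inter_insert_of_notMem h, add_zero]

theorem eq_floor_or_eq_ceil_of_abs_sub_lt_one {m : ℤ} {x : ℝ} (h1 : (m : ℝ) < x + 1)
    (h2 : x < (m : ℝ) + 1) : m = ⌊x⌋ ∨ m = ⌈x⌉ := by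
  rcases le_total (m : ℝ) x with h | h
  · exact Or.inl (Int.floor_eq_iff.2 ⟨h, h2⟩).symm
  · exact Or.inr (Int.ceil_eq_iff.2 ⟨by linarith, h⟩).symm

/-- Quota theorem: a three-part partition of the positive integers into sets whose
counting functions satisfy the quota condition with densities `α, β, γ`. -/
theorem webster_quota_partition (α β γ : ℝ)
    (hα : 0 < α) (hβ : 0 < β) (hγ : 0 < γ)
    (hαi : Irrational α) (hβi : Irrational β) (hγi : Irrational γ)
    (hsum : α + β + γ = 1) (hβhalf : β < 1/2) (hαγ : α < γ) :
    ∃ A B C : Set ℕ,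
      A ∪ B ∪ C = {n : ℕ | 1 ≤ n} ∧
      Disjoint A B ∧ Disjoint A C ∧ Disjoint B C ∧
      (∀ n : ℕ, 1 ≤ n →
        ((wCount A n : ℤ) = ⌊(n : ℝ) * α⌋ ∨ (wCount A n : ℤ) = ⌈(n : ℝ) * α⌉) ∧
        ((wCount B n : ℤ) = ⌊(n : ℝ) * β⌋ ∨ (wCount B n : ℤ) = ⌈(n : ℝ) * β⌉) ∧
        ((wCount C n : ℤ) = ⌊(n : ℝ) * γ⌋ ∨ (wCount C n : ℤ) = ⌈(n : ℝ) * γ⌉)) := by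
  have hw : ∀ i, 0 < (![α, β, γ] : Fin 3 → ℝ) i := by
    intro i
    fin_cases i <;> simpa
  obtain ⟨s, c, h0, hstep, hq⟩ := exists_quota_apportionment ![α, β, γ] hw
    (by simpa [Fin.sum_univ_three] using hsum)
  let S : Fin 3 → Set ℕ := fun i => {n | 1 ≤ n ∧ c (n - 1) = i}
  have hdisj : ∀ i j, i ≠ j → Disjoint (S i) (S j) := fun i j hij =>
    Set.disjoint_left.2 fun n hi hj => hij (hi.2.symm.trans hj.2)
  have hcount : ∀ i n, wCount (S i) n = s n i := by
    intro i n
    induction n with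
    | zero => rw [h0, wCount_zero_of_zero_notMem (by simp [S])]
    | succ n ih => simp [wCount_succ, hstep, ih, S]
  have hquota : ∀ i n, (wCount (S i) n : ℤ) = ⌊(n : ℝ) * (![α, β, γ] : Fin 3 → ℝ) i⌋ ∨
      (wCount (S i) n : ℤ) = ⌈(n : ℝ) * (![α, β, γ] : Fin 3 → ℝ) i⌉ := by
    intro i n
    rw [hcount]
    exact eq_floor_or_eq_ceil_of_abs_sub_lt_one (by exact_mod_cast (hq n i).1)
      (by exact_mod_cast (hq n i).2)
  refine ⟨S 0, S 1, S 2, ?_, hdisj 0 1 (by decide), hdisj 0 2 (by decide),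
    hdisj 1 2 (by decide), fun n _ => ⟨hquota 0 n, hquota 1 n, hquota 2 n⟩⟩
  ext n
  have h3 : ∀ i : Fin 3, i = 0 ∨ i = 1 ∨ i = 2 := by decide
  have := h3 (c (n - 1))
  simp only [S, Set.mem_union, Set.mem_ofPred_eq]
  tauto
end

section
/- Assume α, β, γ are positive irrational numbers with α + β + γ = 1, β < 1/2 and α < γ. Define b̃(n) as follows: with m = b(n), set b̃(n) = b(n) if u_m > α and v_m < β; b̃(n) = b(n) − 1 if u_m < α and β/2 < v_m < β; and b̃(n) = b(n) + 1 if u_m < α and v_m < β/2. Then the range of b̃ equals the set W̃_β = {n ∈ ℕ : (u_n > α and v_n < β) or (u_n > 1 − α and v_n > 1 − β/2) or (α < u_n < 2α and β < v_n < 3β/2)}. -/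
/-- `u_n = {nα + 1/2}` (fractional part), for density `d`. -/
noncomputable def fpart (d : ℝ) (n : ℕ) : ℝ := Int.fract ((n : ℝ) * d + 1/2)

/-- The set `W̃_β` of Algorithm 2. -/
def WtB (α β : ℝ) : Set ℕ := {n : ℕ | 1 ≤ n ∧
  ((α < fpart α n ∧ fpart β n < β) ∨
   (1 - α < fpart α n ∧ 1 - β/2 < fpart β n) ∨
   (α < fpart α n ∧ fpart α n < 2*α ∧ β < fpart β n ∧ fpart β n < 3*β/2))}

theorem Irrational.intCast_mul_ne_odd {d : ℝ} (hd : Irrational d) (a : ℤ) {b : ℤ} (hb : Odd b) :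
    (a : ℝ) * d ≠ b := by
  intro h
  rcases eq_or_ne a 0 with rfl | ha
  · have : b = 0 := by
      have h' : (b : ℝ) = 0 := by rw [← h]; simp
      exact_mod_cast h'
    subst this
    exact absurd hb (by decide)
  · exact (hd.intCast_mul ha).ne_int b h

theorem fpart_eq_sub_floor (d : ℝ) (n : ℕ) :
    fpart d n = (n : ℝ) * d + 1/2 - (⌊(n : ℝ) * d + 1/2⌋ : ℤ) := rfl

theorem fpart_eq_of_eq_add {d t : ℝ} {n : ℕ} (z : ℤ) (h : (n : ℝ) * d + 1/2 = z + t)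
    (ht0 : 0 ≤ t) (ht1 : t < 1) : fpart d n = t := by
  rw [fpart, h, Int.fract_intCast_add, Int.fract_eq_self.2 ⟨ht0, ht1⟩]

theorem fpart_succ_of_lt {d : ℝ} {n : ℕ} (hd : 0 ≤ d) (h : fpart d n + d < 1) :
    fpart d (n + 1) = fpart d n + d := by
  have h0 : 0 ≤ fpart d n := Int.fract_nonneg _
  refine fpart_eq_of_eq_add ⌊(n : ℝ) * d + 1/2⌋ ?_ (by linarith) h
  rw [fpart_eq_sub_floor]
  push_cast
  ring

theorem fpart_succ_of_le {d : ℝ} {n : ℕ} (hd : d ≤ 1) (h : 1 ≤ fpart d n + d) :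
    fpart d (n + 1) = fpart d n + d - 1 := by
  have h1 : fpart d n < 1 := Int.fract_lt_one _
  refine fpart_eq_of_eq_add (⌊(n : ℝ) * d + 1/2⌋ + 1) ?_ (by linarith) (by linarith)
  rw [fpart_eq_sub_floor]
  push_cast
  ring

theorem fpart_pos {d : ℝ} (hd : Irrational d) (n : ℕ) : 0 < fpart d n := by
  refine lt_of_le_of_ne (Int.fract_nonneg _) fun h => ?_
  rw [fpart_eq_sub_floor] at h
  refine hd.intCast_mul_ne_odd (2 * n) (b := 2 * ⌊(n : ℝ) * d + 1/2⌋ - 1) ⟨_ - 1, by ring⟩ ?_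
  push_cast
  linarith

theorem fpart_ne_self {d : ℝ} (hd : Irrational d) (n : ℕ) : fpart d n ≠ d := by
  intro h
  rw [fpart_eq_sub_floor] at h
  refine hd.intCast_mul_ne_odd (2 * n - 2) (b := 2 * ⌊(n : ℝ) * d + 1/2⌋ - 1)
    ⟨_ - 1, by ring⟩ ?_
  push_cast
  linarith

theorem fpart_ne_half {d : ℝ} (hd : Irrational d) (n : ℕ) : fpart d n ≠ d / 2 := by
  intro h
  rw [fpart_eq_sub_floor] at h
  refine hd.intCast_mul_ne_odd (2 * n - 1) (b := 2 * ⌊(n : ℝ) * d + 1/2⌋ - 1)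
    ⟨_ - 1, by ring⟩ ?_
  push_cast
  linarith

theorem fpart_one {d : ℝ} (hd : 0 ≤ d) (hd' : d < 1/2) : fpart d 1 = d + 1/2 :=
  fpart_eq_of_eq_add 0 (by simp) (by linarith) (by linarith)

theorem one_le_wTerm {d : ℝ} (hd : 0 < d) {n : ℕ} (hn : 1 ≤ n) : 1 ≤ wTerm d n := by
  have hn' : (1 : ℝ) ≤ n := by exact_mod_cast hn
  exact Nat.ceil_pos.2 (div_pos (by linarith) hd)

theorem fpart_wTerm_lt {d : ℝ} (hd : 0 < d) (hd' : d ≤ 1) {n : ℕ} (hn : 1 ≤ n) :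
    fpart d (wTerm d n) < d := by
  have hn' : (1 : ℝ) ≤ n := by exact_mod_cast hn
  have h1 : ((n : ℝ) - 1/2) / d ≤ wTerm d n := Nat.le_ceil _
  have h2 : (wTerm d n : ℝ) < ((n : ℝ) - 1/2) / d + 1 :=
    Nat.ceil_lt_add_one (div_nonneg (by linarith) hd.le)
  rw [div_le_iff₀ hd] at h1
  rw [← sub_lt_iff_lt_add, lt_div_iff₀ hd] at h2
  have h := fpart_eq_of_eq_add (d := d) (n := wTerm d n) (t := wTerm d n * d + 1/2 - n) n
    (by push_cast; ring) (by linarith) (by linarith)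
  rw [h]
  linarith

theorem exists_wTerm_eq {d : ℝ} (hd : 0 < d) (hd' : d < 1/2) {k : ℕ} (h : fpart d k < d) :
    ∃ n, 1 ≤ n ∧ wTerm d n = k := by
  have h0 : 0 ≤ fpart d k := Int.fract_nonneg _
  have hkd : 0 ≤ (k : ℝ) * d := by positivity
  rw [fpart_eq_sub_floor] at h h0
  have hz : 0 < ⌊(k : ℝ) * d + 1/2⌋ := by
    have : (0 : ℝ) < (⌊(k : ℝ) * d + 1/2⌋ : ℤ) := by linarith
    exact_mod_cast this
  obtain ⟨n, hn⟩ := Int.eq_ofNat_of_zero_le hz.le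
  rw [hn] at h h0 hz
  push_cast at h h0
  have hn1 : 1 ≤ n := by omega
  have hk : k ≠ 0 := by
    rintro rfl
    have : (1 : ℝ) ≤ n := by exact_mod_cast hn1
    norm_num at h0
    linarith
  refine ⟨n, hn1, (Nat.ceil_eq_iff hk).2 ⟨?_, ?_⟩⟩
  · rw [Nat.cast_sub (Nat.one_le_iff_ne_zero.2 hk), lt_div_iff₀ hd]
    push_cast
    linarith
  · rw [div_le_iff₀ hd]
    linarith

/-- Equivalence of Algorithm 1 and Algorithm 2 for the sequence of density `β`:
the range of the perturbed sequence `b̃` equals the set `W̃_β`. -/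
theorem algorithms_equivalent_beta (α β γ : ℝ)
    (hα : 0 < α) (hβ : 0 < β) (hγ : 0 < γ)
    (hαi : Irrational α) (hβi : Irrational β) (hγi : Irrational γ)
    (hsum : α + β + γ = 1) (hβhalf : β < 1/2) (hαγ : α < γ)
    (bt : ℕ → ℕ)
    (h0 : ∀ n : ℕ, 1 ≤ n →
      (α < fpart α (wTerm β n) ∧ fpart β (wTerm β n) < β) → bt n = wTerm β n)
    (hm1 : ∀ n : ℕ, 1 ≤ n →
      (fpart α (wTerm β n) < α ∧ β/2 < fpart β (wTerm β n) ∧ fpart β (wTerm β n) < β) →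
      (bt n : ℤ) = (wTerm β n : ℤ) - 1)
    (hp1 : ∀ n : ℕ, 1 ≤ n →
      (fpart α (wTerm β n) < α ∧ fpart β (wTerm β n) < β/2) → bt n = wTerm β n + 1) :
    bt '' {n : ℕ | 1 ≤ n} = WtB α β := by
  have hα2 : 2 * α < 1 := by linarith
  ext k
  constructor
  · rintro ⟨n, hn : 1 ≤ n, rfl⟩
    have hm := one_le_wTerm hβ hn
    have hv := fpart_wTerm_lt hβ (by linarith) hn
    have h0 := h0 n hn
    have hm1 := hm1 n hn
    have hp1 := hp1 n hn
    generalize wTerm β n = m at *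
    have hu0 := fpart_pos hαi m
    have hv0 := fpart_pos hβi m
    rcases lt_or_gt_of_ne (fpart_ne_self hαi m) with hu | hu
    · rcases lt_or_gt_of_ne (fpart_ne_half hβi m) with hv2 | hv2
      · rw [hp1 ⟨hu, hv2⟩]
        refine ⟨by omega, Or.inr (Or.inr ?_)⟩
        rw [fpart_succ_of_lt hα.le (by linarith), fpart_succ_of_lt hβ.le (by linarith)]
        refine ⟨?_, ?_, ?_, ?_⟩ <;> linarith
      · have hb := hm1 ⟨hu, hv2, hv⟩
        have hne : m ≠ 1 := by
          rintro rfl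
          rw [fpart_one hα.le (by linarith)] at hu
          linarith
        obtain rfl : m = bt n + 1 := by omega
        refine ⟨by omega, Or.inr (Or.inl ?_)⟩
        have hu' : 1 ≤ fpart α (bt n) + α := by
          by_contra! h
          rw [fpart_succ_of_lt hα.le h] at hu
          linarith [fpart_pos hαi (bt n)]
        have hv' : 1 ≤ fpart β (bt n) + β := by
          by_contra! h
          rw [fpart_succ_of_lt hβ.le h] at hv
          linarith [fpart_pos hβi (bt n)]
        rw [fpart_succ_of_le (by linarith) hu'] at hu0
        rw [fpart_succ_of_le (by linarith) hv'] at hv2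
        constructor <;> linarith
    · rw [h0 ⟨hu, hv⟩]
      exact ⟨hm, Or.inl ⟨hu, hv⟩⟩
  · rintro ⟨hk, ⟨hu, hv⟩ | ⟨hu, hv⟩ | ⟨hu, hu2, hv, hv2⟩⟩
    · obtain ⟨n, hn, rfl⟩ := exists_wTerm_eq hβ hβhalf hv
      exact ⟨n, hn, h0 n hn ⟨hu, hv⟩⟩
    · have hu1 : fpart α k < 1 := Int.fract_lt_one _
      have hv1 : fpart β k < 1 := Int.fract_lt_one _
      have hu' := fpart_succ_of_le (d := α) (n := k) (by linarith) (by linarith)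
      have hv' := fpart_succ_of_le (d := β) (n := k) (by linarith) (by linarith)
      obtain ⟨n, hn, h⟩ := exists_wTerm_eq (k := k + 1) hβ hβhalf (by linarith)
      have hb := hm1 n hn (by rw [h]; refine ⟨?_, ?_, ?_⟩ <;> linarith)
      exact ⟨n, hn, by omega⟩
    · obtain ⟨m, rfl⟩ : ∃ m, k = m + 1 := ⟨k - 1, by omega⟩
      have hu' : fpart α (m + 1) = fpart α m + α := by
        refine fpart_succ_of_lt hα.le ?_
        by_contra! h
        rw [fpart_succ_of_le (by linarith) h] at hu
        linarith [show fpart α m < 1 from Int.fract_lt_one _]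
      have hv' : fpart β (m + 1) = fpart β m + β := by
        refine fpart_succ_of_lt hβ.le ?_
        by_contra! h
        rw [fpart_succ_of_le (by linarith) h] at hv
        linarith [show fpart β m < 1 from Int.fract_lt_one _]
      obtain ⟨n, hn, h⟩ := exists_wTerm_eq (k := m) hβ hβhalf (by linarith)
      exact ⟨n, hn, by rw [hp1 n hn (by rw [h]; constructor <;> linarith), h]⟩
end

section
/- Let α ∈ (0,1) be irrational and let W_α = {⌈(n − 1/2)/α⌉ : n ∈ ℕ} be the Webster sequence of density α. Then for every m ∈ ℕ, m ∈ W_α if and only if {mα + 1/2} < α. -/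
/-- A positive integer `m` is the `n`-th Webster term exactly when `m * d + 1/2` lies in
`[n, n + d)`. -/
theorem eq_wTerm_iff {d : ℝ} (hd : 0 < d) {m : ℕ} (hm : 1 ≤ m) (n : ℕ) :
    m = wTerm d n ↔ (n : ℝ) ≤ m * d + 1 / 2 ∧ (m : ℝ) * d + 1 / 2 < n + d := by
  rw [eq_comm, wTerm, Nat.ceil_eq_iff (by omega), lt_div_iff₀ hd, div_le_iff₀ hd,
    Nat.cast_sub hm, Nat.cast_one]
  constructor <;> rintro ⟨h1, h2⟩ <;> constructor <;> linarith

/-- Membership criterion for the Webster sequence: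
`m ∈ W_α ↔ {mα + 1/2} < α`. -/
theorem webster_membership_criterion (α : ℝ) (hα0 : 0 < α) (hα1 : α < 1)
    (hαi : Irrational α) :
    ∀ m : ℕ, 1 ≤ m → (m ∈ wSet α ↔ Int.fract ((m : ℝ) * α + 1/2) < α) := by
  intro m hm
  constructor
  · rintro ⟨n, -, hn⟩
    obtain ⟨h1, h2⟩ := (eq_wTerm_iff hα0 hm n).1 hn
    have hfl : ⌊(m : ℝ) * α + 1 / 2⌋ = (n : ℤ) :=
      Int.floor_eq_iff.2 ⟨by exact_mod_cast h1, by push_cast; linarith⟩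
    rw [Int.fract, hfl, Int.cast_natCast]
    linarith
  · intro h
    have hm' : (1 : ℝ) ≤ m := by exact_mod_cast hm
    have hfract := Int.self_sub_floor ((m : ℝ) * α + 1 / 2)
    have hpos : 0 < ⌊(m : ℝ) * α + 1 / 2⌋ := by
      have : (0 : ℝ) < ⌊(m : ℝ) * α + 1 / 2⌋ := by nlinarith
      exact_mod_cast this
    obtain ⟨n, hn⟩ := Int.eq_ofNat_of_zero_le hpos.le
    refine ⟨n, by omega, (eq_wTerm_iff hα0 hm n).2 ?_⟩
    have hle := Int.floor_le ((m : ℝ) * α + 1 / 2)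
    rw [hn, Int.cast_natCast] at hfract hle
    exact ⟨hle, by linarith⟩
end

section
/- Let α ∈ (0,1) be irrational, let W_α = {⌈(n − 1/2)/α⌉ : n ∈ ℕ} be the Webster sequence of density α, and let k = ⌊1/α⌋. If m ∈ W_α and m′ is the smallest element of W_α greater than m, then m′ = m + k or m′ = m + k + 1. Moreover, for every m ∈ ℕ: (m ∈ W_α and m′ = m + k) if and only if {1/α}·α < {mα + 1/2} < α; and (m ∈ W_α and m′ = m + k + 1) if and only if {mα + 1/2} < {1/α}·α. -/
/-- `m` is the `n`-th Webster term iff `n ≤ m * d + 1/2 < n + d`. -/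
theorem wTerm_eq_iff {d : ℝ} (hd : 0 < d) {n : ℕ} (hn : 1 ≤ n) (m : ℕ) :
    wTerm d n = m ↔ (n : ℝ) ≤ m * d + 1/2 ∧ (m : ℝ) * d + 1/2 < n + d := by
  have hn' : (1 : ℝ) ≤ n := by exact_mod_cast hn
  rcases Nat.eq_zero_or_pos m with rfl | hm
  · have hpos : 0 < ((n : ℝ) - 1/2) / d := div_pos (by linarith) hd
    have hne : wTerm d n ≠ 0 := (Nat.ceil_pos.2 hpos).ne'
    simp only [hne, false_iff, Nat.cast_zero, not_and]
    intro h
    linarith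
  · rw [wTerm, Nat.ceil_eq_iff hm.ne', div_le_iff₀ hd, lt_div_iff₀ hd, Nat.cast_pred hm]
    constructor <;> rintro ⟨h₁, h₂⟩ <;> constructor <;> linarith

theorem monotone_wTerm {d : ℝ} (hd : 0 < d) : Monotone (wTerm d) := by
  intro a b hab
  have hab' : (a : ℝ) ≤ b := by exact_mod_cast hab
  unfold wTerm
  gcongr

theorem wTerm_lt_succ {d : ℝ} (hd : 0 < d) (hd1 : d < 1) {n : ℕ} (hn : 1 ≤ n) :
    wTerm d n < wTerm d (n + 1) := by
  have h := ((wTerm_eq_iff hd hn _).1 rfl).2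
  rw [wTerm.eq_1 d (n + 1), Nat.lt_ceil, lt_div_iff₀ hd]
  push_cast
  linarith

theorem isLeast_wTerm_succ {d : ℝ} (hd : 0 < d) (hd1 : d < 1) {n : ℕ} (hn : 1 ≤ n) :
    IsLeast {x : ℕ | x ∈ wSet d ∧ wTerm d n < x} (wTerm d (n + 1)) := by
  refine ⟨⟨⟨n + 1, by omega, rfl⟩, wTerm_lt_succ hd hd1 hn⟩, ?_⟩
  rintro _ ⟨⟨j, -, rfl⟩, hlt⟩
  exact monotone_wTerm hd ((monotone_wTerm hd).reflect_lt hlt)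

theorem isLeast_wSet_iff {d : ℝ} (hd : 0 < d) (hd1 : d < 1) {n : ℕ} (hn : 1 ≤ n) (m' : ℕ) :
    IsLeast {x : ℕ | x ∈ wSet d ∧ wTerm d n < x} m' ↔
      (n : ℝ) + 1 ≤ m' * d + 1/2 ∧ (m' : ℝ) * d + 1/2 < n + 1 + d := by
  have h := wTerm_eq_iff hd (Nat.le_add_left 1 n) m'
  push_cast at h
  rw [← h]
  exact ⟨fun hm => (isLeast_wTerm_succ hd hd1 hn).unique hm,
    fun hm => hm ▸ isLeast_wTerm_succ hd hd1 hn⟩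

theorem fract_eq_of_wTerm {d : ℝ} (hd : 0 < d) (hd1 : d < 1) {n : ℕ} (hn : 1 ≤ n) :
    Int.fract ((wTerm d n : ℝ) * d + 1/2) = (wTerm d n : ℝ) * d + 1/2 - n := by
  obtain ⟨h₁, h₂⟩ := (wTerm_eq_iff hd hn _).1 rfl
  exact Int.fract_eq_iff.2 ⟨by linarith, by linarith, n, by push_cast; ring⟩

theorem mem_wSet_of_fract_lt {d : ℝ} (hd : 0 < d) {m : ℕ} (hm : 1 ≤ m)
    (h : Int.fract ((m : ℝ) * d + 1/2) < d) : m ∈ wSet d := by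
  have hm' : (1 : ℝ) ≤ m := by exact_mod_cast hm
  have hmd : d ≤ m * d := le_mul_of_one_le_left hd.le hm'
  have hfloor : (⌊(m : ℝ) * d + 1/2⌋₊ : ℝ) + Int.fract ((m : ℝ) * d + 1/2) = m * d + 1/2 := by
    rw [natCast_floor_eq_intCast_floor (by positivity), Int.floor_add_fract]
  have hfr := Int.fract_nonneg ((m : ℝ) * d + 1/2)
  have hpos : (0 : ℝ) < ⌊(m : ℝ) * d + 1/2⌋₊ := by linarith
  have hn : 1 ≤ ⌊(m : ℝ) * d + 1/2⌋₊ := by exact_mod_cast hpos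
  exact ⟨_, hn, ((wTerm_eq_iff hd hn m).2 ⟨by linarith, by linarith⟩).symm⟩

theorem fract_one_div_mul {d : ℝ} (hd : 0 < d) :
    Int.fract (1/d) * d = 1 - ⌊1/d⌋₊ * d := by
  rw [Int.fract, ← natCast_floor_eq_intCast_floor (by positivity), sub_mul,
    div_mul_cancel₀ _ hd.ne']

/-- No Webster term sits on the boundary between the two gap lengths. -/
theorem natCast_mul_add_half_ne {d : ℝ} (hdi : Irrational d) (a n : ℕ) :
    (a : ℝ) * d + 1/2 ≠ n + 1 := by
  intro h
  have ha : a ≠ 0 := by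
    rintro rfl
    have h' : (1 : ℝ) = 2 * n + 2 := by push_cast at h; linarith
    norm_cast at h'
    omega
  refine (hdi.natCast_mul ha).ne_rat ((n : ℚ) + 1/2) ?_
  push_cast
  linarith

/-- Gap criterion for the Webster sequence, with `k = ⌊1/α⌋`:
gaps are `k` or `k+1`, together with the criteria characterizing each case. -/
theorem webster_gap_criterion (α : ℝ) (hα0 : 0 < α) (hα1 : α < 1)
    (hαi : Irrational α) (k : ℕ) (hk : k = ⌊1/α⌋₊) :
    (∀ m m' : ℕ, m ∈ wSet α →
      IsLeast {x : ℕ | x ∈ wSet α ∧ m < x} m' →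
      (m' = m + k ∨ m' = m + k + 1)) ∧
    (∀ m : ℕ, 1 ≤ m →
      ((m ∈ wSet α ∧ IsLeast {x : ℕ | x ∈ wSet α ∧ m < x} (m + k)) ↔
        (Int.fract (1/α) * α < Int.fract ((m : ℝ) * α + 1/2) ∧
          Int.fract ((m : ℝ) * α + 1/2) < α))) ∧
    (∀ m : ℕ, 1 ≤ m →
      ((m ∈ wSet α ∧ IsLeast {x : ℕ | x ∈ wSet α ∧ m < x} (m + k + 1)) ↔
        Int.fract ((m : ℝ) * α + 1/2) < Int.fract (1/α) * α)) := by
  have hr := fract_one_div_mul hα0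
  have hr0 : 0 ≤ Int.fract (1/α) * α := mul_nonneg (Int.fract_nonneg _) hα0.le
  have hrα : Int.fract (1/α) * α < α :=
    mul_lt_of_lt_one_left hα0 (Int.fract_lt_one _)
  rw [← hk] at hr
  refine ⟨?_, fun m hm => ⟨?_, ?_⟩, fun m hm => ⟨?_, ?_⟩⟩
  · rintro _ m' ⟨n, hn, rfl⟩ hm'
    obtain ⟨h₁, h₂⟩ := (wTerm_eq_iff hα0 hn _).1 rfl
    rcases le_or_gt ((n : ℝ) + 1) ((wTerm α n + k : ℕ) * α + 1/2) with h | h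
    · refine Or.inl (hm'.unique ((isLeast_wSet_iff hα0 hα1 hn _).2 ⟨h, ?_⟩))
      push_cast
      linarith
    · refine Or.inr (hm'.unique ((isLeast_wSet_iff hα0 hα1 hn _).2 ?_))
      push_cast at h ⊢
      constructor <;> linarith
  · rintro ⟨⟨n, hn, rfl⟩, hl⟩
    obtain ⟨h₁, h₂⟩ := (wTerm_eq_iff hα0 hn _).1 rfl
    have h₃ := ((isLeast_wSet_iff hα0 hα1 hn _).1 hl).1.lt_of_ne
      (natCast_mul_add_half_ne hαi _ n).symm
    rw [fract_eq_of_wTerm hα0 hα1 hn]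
    push_cast at h₃
    constructor <;> linarith
  · rintro ⟨hlo, hhi⟩
    have hmem := mem_wSet_of_fract_lt hα0 hm hhi
    refine ⟨hmem, ?_⟩
    obtain ⟨n, hn, rfl⟩ := hmem
    rw [fract_eq_of_wTerm hα0 hα1 hn] at hlo hhi
    rw [isLeast_wSet_iff hα0 hα1 hn]
    push_cast
    constructor <;> linarith
  · rintro ⟨⟨n, hn, rfl⟩, hl⟩
    have h₃ := ((isLeast_wSet_iff hα0 hα1 hn _).1 hl).2
    rw [fract_eq_of_wTerm hα0 hα1 hn]
    push_cast at h₃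
    linarith
  · intro hlo
    have hmem := mem_wSet_of_fract_lt hα0 hm (hlo.trans hrα)
    refine ⟨hmem, ?_⟩
    obtain ⟨n, hn, rfl⟩ := hmem
    obtain ⟨h₁, h₂⟩ := (wTerm_eq_iff hα0 hn _).1 rfl
    rw [fract_eq_of_wTerm hα0 hα1 hn] at hlo
    rw [isLeast_wSet_iff hα0 hα1 hn]
    push_cast
    constructor <;> linarith
end

section
/- Assume α, β, γ are positive irrational numbers with α + β + γ = 1, β < 1/2 and α < γ. Then for every n ∈ ℕ, ⌊nα + 1/2⌋ + ⌊nβ + 1/2⌋ + ⌊nγ + 1/2⌋ = n − δ(u_n, v_n) + δ({u_n + v_n − 1/2}, 1/2), where δ(s,t) = 1 if s + t ≥ 1 and δ(s,t) = 0 if s + t < 1, u_n = {nα + 1/2}, and v_n = {nβ + 1/2}. -/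
/-- `δ(s,t) = 1` if `s + t ≥ 1`, and `0` otherwise. -/
noncomputable def deltaFn (s t : ℝ) : ℤ := if 1 ≤ s + t then 1 else 0

/-- For `0 ≤ s < 2` with `s ∉ {1/2, 3/2}`, the integer part of `3/2 - s` in terms of `deltaFn`. -/
theorem floor_three_halves_sub {u v : ℝ} (h0 : 0 ≤ u + v) (h2 : u + v < 2)
    (hs : u + v ≠ 1/2) (hs' : u + v ≠ 3/2) :
    ⌊3/2 - (u + v)⌋ = -deltaFn u v + deltaFn (Int.fract (u + v - 1/2)) (1/2) := by
  have fract_eq (k : ℤ) (hk : (k : ℝ) ≤ u + v - 1/2) (hk' : u + v - 1/2 < k + 1) :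
      Int.fract (u + v - 1/2) = u + v - 1/2 - k := by
    rw [← Int.self_sub_floor, Int.floor_eq_iff.mpr ⟨hk, hk'⟩]
  unfold deltaFn
  rcases hs.lt_or_gt with h | h
  · rw [fract_eq (-1) (by push_cast; linarith) (by push_cast; linarith),
      if_neg (by linarith), if_pos (by push_cast; linarith), Int.floor_eq_iff]
    constructor <;> push_cast <;> linarith
  rcases hs'.lt_or_gt with h' | h'
  · rw [fract_eq 0 (by push_cast; linarith) (by push_cast; linarith)]
    by_cases h1 : 1 ≤ u + v
    · rw [if_pos h1, if_pos (by push_cast; linarith), Int.floor_eq_iff]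
      constructor <;> push_cast <;> linarith
    · rw [if_neg h1, if_neg (by push_cast; linarith), Int.floor_eq_iff]
      constructor <;> push_cast <;> linarith
  · rw [fract_eq 1 (by push_cast; linarith) (by push_cast; linarith),
      if_pos (by linarith), if_neg (by push_cast; linarith), Int.floor_eq_iff]
    constructor <;> push_cast <;> linarith

/-- Sum of the three Webster counting functions:
`⌊nα+1/2⌋ + ⌊nβ+1/2⌋ + ⌊nγ+1/2⌋ = n − δ(u_n,v_n) + δ({u_n+v_n−1/2}, 1/2)`. -/
theorem webster_three_counting_sum (α β γ : ℝ)
    (hα : 0 < α) (hβ : 0 < β) (hγ : 0 < γ)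
    (hαi : Irrational α) (hβi : Irrational β) (hγi : Irrational γ)
    (hsum : α + β + γ = 1) (hβhalf : β < 1/2) (hαγ : α < γ) :
    ∀ n : ℕ, 1 ≤ n →
      ⌊(n : ℝ) * α + 1/2⌋ + ⌊(n : ℝ) * β + 1/2⌋ + ⌊(n : ℝ) * γ + 1/2⌋ =
        (n : ℤ) - deltaFn (fpart α n) (fpart β n) +
          deltaFn (Int.fract (fpart α n + fpart β n - 1/2)) (1/2) := by
  intro n hn
  have hu := Int.floor_add_fract ((n : ℝ) * α + 1/2)
  have hv := Int.floor_add_fract ((n : ℝ) * β + 1/2)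
  have hu0 := Int.fract_nonneg ((n : ℝ) * α + 1/2)
  have hv0 := Int.fract_nonneg ((n : ℝ) * β + 1/2)
  have hu1 := Int.fract_lt_one ((n : ℝ) * α + 1/2)
  have hv1 := Int.fract_lt_one ((n : ℝ) * β + 1/2)
  have hnγ : (n : ℝ) * γ = n - n * α - n * β := by
    linear_combination (n : ℝ) * hsum
  have hirr : Irrational ((n : ℝ) * γ) := hγi.natCast_mul (by lia)
  rw [← fpart] at hu hu0 hu1 hv hv0 hv1
  generalize fpart α n = u at *
  generalize fpart β n = v at *
  generalize ⌊(n : ℝ) * α + 1/2⌋ = A at *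
  generalize ⌊(n : ℝ) * β + 1/2⌋ = B at *
  have hγ_eq : (n : ℝ) * γ + 1/2 = ((n - A - B : ℤ) : ℝ) + (3/2 - (u + v)) := by
    push_cast
    linarith
  have hs : u + v ≠ 1/2 := fun h =>
    hirr.ne_rat (n - A - B + 1/2) (by push_cast at hγ_eq ⊢; linarith)
  have hs' : u + v ≠ 3/2 := fun h =>
    hirr.ne_rat (n - A - B - 1/2) (by push_cast at hγ_eq ⊢; linarith)
  rw [hγ_eq, Int.floor_intCast_add,
    floor_three_halves_sub (by linarith) (by linarith) hs hs']
  ring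
end

section
/- Assume α, β, γ are positive irrational numbers with α + β + γ = 1, β < 1/2 and α < γ, and let W̃_γ be as defined in the context, with c̃(n) its n-th smallest element and c(n) = ⌈(n − 1/2)/γ⌉ the n-th term of the Webster sequence W_γ. Then for every n ∈ ℕ, c(n) − 1 ≤ c̃(n) ≤ c(n) + 1. -/
/-- The set `W̃_α` of Algorithm 2. -/
def WtA (α : ℝ) : Set ℕ := {n : ℕ | 1 ≤ n ∧ fpart α n < α}

/-- The set `W̃_γ` of Algorithm 2. -/
def WtC (α β : ℝ) : Set ℕ := {n : ℕ | 1 ≤ n} \ (WtA α ∪ WtB α β)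

/-- The `n`-th smallest element (1-indexed) of a set of naturals. -/
noncomputable def nthElt (S : Set ℕ) (n : ℕ) : ℕ := Nat.nth (· ∈ S) (n - 1)

/-- For irrational `d`, the fractional part of `N * d + 1/2` is never a half-integer
multiple of `d`. -/
theorem fpart_ne_mul_half {d : ℝ} (hd : Irrational d) (N : ℕ) (k : ℤ) :
    fpart d N ≠ k * d / 2 := by
  intro h
  have hfr : (⌊(N : ℝ) * d + 1/2⌋ : ℝ) + fpart d N = N * d + 1/2 := Int.floor_add_fract _
  generalize ⌊(N : ℝ) * d + 1/2⌋ = b at hfr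
  have hlin : ((2 * N - k : ℤ) : ℝ) * d = ((2 * b - 1 : ℤ) : ℝ) := by
    push_cast
    linarith
  by_cases hz : (2 * N - k : ℤ) = 0
  · rw [hz, Int.cast_zero, zero_mul] at hlin
    have : 2 * b - 1 = 0 := by exact_mod_cast hlin.symm
    omega
  · exact (hd.intCast_mul hz).ne_int _ hlin

/-- Advancing the index by one either adds `d` to `fpart d`, or also wraps around and
increments the integer part. -/
theorem fpart_succ {d : ℝ} (h0 : 0 < d) (h1 : d < 1) (N : ℕ) :
    (⌊((N + 1 : ℕ) : ℝ) * d + 1/2⌋ = ⌊(N : ℝ) * d + 1/2⌋ ∧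
      fpart d (N + 1) = fpart d N + d ∧ d ≤ fpart d (N + 1)) ∨
    (⌊((N + 1 : ℕ) : ℝ) * d + 1/2⌋ = ⌊(N : ℝ) * d + 1/2⌋ + 1 ∧
      fpart d (N + 1) = fpart d N + d - 1 ∧ fpart d (N + 1) < d) := by
  have hN : (⌊(N : ℝ) * d + 1/2⌋ : ℝ) + fpart d N = N * d + 1/2 := Int.floor_add_fract _
  have hS : (⌊((N + 1 : ℕ) : ℝ) * d + 1/2⌋ : ℝ) + fpart d (N + 1) = (N + 1 : ℕ) * d + 1/2 :=
    Int.floor_add_fract _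
  have hN0 : 0 ≤ fpart d N := Int.fract_nonneg _
  have hN1 : fpart d N < 1 := Int.fract_lt_one _
  have hS0 : 0 ≤ fpart d (N + 1) := Int.fract_nonneg _
  have hS1 : fpart d (N + 1) < 1 := Int.fract_lt_one _
  generalize ⌊(N : ℝ) * d + 1/2⌋ = a at *
  generalize ⌊((N + 1 : ℕ) : ℝ) * d + 1/2⌋ = a' at *
  push_cast at hS
  have hlo : a - 1 < a' := by
    have : (a : ℝ) - 1 < a' := by linarith
    exact_mod_cast this
  have hhi : a' < a + 2 := by
    have : (a' : ℝ) < a + 2 := by linarith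
    exact_mod_cast this
  obtain h | h : a' = a ∨ a' = a + 1 := by omega
  · left
    subst h
    exact ⟨rfl, by linarith, by linarith⟩
  · right
    subst h
    push_cast at hS
    exact ⟨rfl, by linarith, by linarith⟩

/-- The correction, at fractional parts `u` and `v`, to the number of elements of `W_β`:
one element is pulled in from the right, or one is pushed out to the right. -/
noncomputable def betaShift (α β u v : ℝ) : ℤ :=
  (if 1 - α < u ∧ 1 - β/2 < v then 1 else 0) - (if u < α ∧ v < β/2 then 1 else 0)

open Classical in
/-- The number of elements of `W̃_γ` up to `N`. -/
theorem count_WtC {α β : ℝ} (hα : 0 < α) (hβ : 0 < β)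
    (hαi : Irrational α) (hβi : Irrational β) (hαhalf : α < 1/2) (hβhalf : β < 1/2) (N : ℕ) :
    (Nat.count (· ∈ WtC α β) (N + 1) : ℤ) = N - ⌊(N : ℝ) * α + 1/2⌋ - ⌊(N : ℝ) * β + 1/2⌋
      - betaShift α β (fpart α N) (fpart β N) := by
  induction N with
  | zero =>
    have hf : ⌊(1 / 2 : ℝ)⌋ = 0 := by norm_num
    have hfr : Int.fract (1 / 2 : ℝ) = 1 / 2 := by
      rw [Int.fract_eq_iff]
      exact ⟨by norm_num, by norm_num, 0, by norm_num⟩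
    have h1 : ¬ (1 - α < 1/2) := by linarith
    have h2 : ¬ (1/2 < α) := by linarith
    have h0 : 0 ∉ WtC α β := fun h => absurd h.1 (by simp)
    simp only [Nat.count_succ, Nat.count_zero, h0, fpart, betaShift, Nat.cast_zero, zero_mul,
      zero_add, hf, hfr, h1, h2, false_and, if_false]
    norm_num
  | succ N ih =>
    have hu0 : 0 ≤ fpart α N := Int.fract_nonneg _
    have hu1 : fpart α N < 1 := Int.fract_lt_one _
    have hv0 : 0 ≤ fpart β N := Int.fract_nonneg _
    have hv1 : fpart β N < 1 := Int.fract_lt_one _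
    have hu0' : 0 ≤ fpart α (N + 1) := Int.fract_nonneg _
    have hv0' : 0 ≤ fpart β (N + 1) := Int.fract_nonneg _
    have hu1' : fpart α (N + 1) < 1 := Int.fract_lt_one _
    have hv1' : fpart β (N + 1) < 1 := Int.fract_lt_one _
    have hu0ne : fpart α (N + 1) ≠ 0 := by simpa using fpart_ne_mul_half hαi (N + 1) 0
    have huα : fpart α (N + 1) ≠ α := by simpa using fpart_ne_mul_half hαi (N + 1) 2
    have hvβ : fpart β (N + 1) ≠ β := by simpa using fpart_ne_mul_half hβi (N + 1) 2
    have hvβ2 : fpart β (N + 1) ≠ β / 2 := by simpa using fpart_ne_mul_half hβi (N + 1) 1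
    have hmem : N + 1 ∈ WtC α β ↔ ¬ (fpart α (N + 1) < α) ∧
        ¬ ((α < fpart α (N + 1) ∧ fpart β (N + 1) < β) ∨
          (1 - α < fpart α (N + 1) ∧ 1 - β/2 < fpart β (N + 1)) ∨
          (α < fpart α (N + 1) ∧ fpart α (N + 1) < 2*α ∧
            β < fpart β (N + 1) ∧ fpart β (N + 1) < 3*β/2)) := by
      simp [WtC, WtA, WtB]
    rw [Nat.count_succ, Nat.cast_add, ih, if_congr hmem rfl rfl]
    have hA := fpart_succ hα (by linarith) N
    have hB := fpart_succ hβ (by linarith) N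
    generalize fpart α N = u at *
    generalize fpart β N = v at *
    generalize fpart α (N + 1) = u' at *
    generalize fpart β (N + 1) = v' at *
    unfold betaShift
    rcases hA with ⟨ha, hu, hua⟩ | ⟨ha, hu, hua⟩ <;>
    rcases hB with ⟨hb, hv, hvb⟩ | ⟨hb, hv, hvb⟩ <;>
    rw [ha, hb] <;> push_cast <;> clear ih hmem ha hb <;>
    grind

/-- Bounds on the discrepancy of `W̃_γ` at fractional parts `u` and `v`. -/
theorem betaShift_bounds {α β γ u v : ℝ}
    (hsum : α + β + γ = 1) (hβhalf : β < 1/2) (hαγ : α < γ)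
    (hu0 : 0 ≤ u) (hu1 : u < 1) (hv0 : 0 ≤ v) (hv1 : v < 1) :
    1/2 - γ < u + v - betaShift α β u v ∧ u + v - betaShift α β u v ≤ γ + 3/2 := by
  unfold betaShift
  split_ifs with h1 h2 h2
  · constructor <;> push_cast <;> linarith [h1.1, h2.1]
  · constructor <;> push_cast <;> linarith [h1.1, h1.2]
  · constructor <;> push_cast <;> linarith [h2.1, h2.2]
  · push_cast
    rw [not_and_or, not_lt, not_lt] at h1 h2
    constructor
    · rcases h2 with h | h <;> linarith
    · rcases h1 with h | h <;> linarith

open Classical in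
/-- The number of elements of `W̃_γ` up to `N` lies between the numbers of elements of `W_γ`
up to `N - 1` and up to `N + 1`. -/
theorem count_WtC_bounds {α β γ : ℝ} (hα : 0 < α) (hβ : 0 < β)
    (hαi : Irrational α) (hβi : Irrational β)
    (hsum : α + β + γ = 1) (hβhalf : β < 1/2) (hαγ : α < γ) (N : ℕ) :
    ((N : ℝ) - 1) * γ - 1/2 < Nat.count (· ∈ WtC α β) (N + 1) ∧
      (Nat.count (· ∈ WtC α β) (N + 1) : ℝ) ≤ (N + 1) * γ + 1/2 := by
  have hc : (Nat.count (· ∈ WtC α β) (N + 1) : ℝ) = N - ⌊(N : ℝ) * α + 1/2⌋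
      - ⌊(N : ℝ) * β + 1/2⌋ - betaShift α β (fpart α N) (fpart β N) := by
    exact_mod_cast count_WtC hα hβ hαi hβi (by linarith) hβhalf N
  have ha : (⌊(N : ℝ) * α + 1/2⌋ : ℝ) + fpart α N = N * α + 1/2 := Int.floor_add_fract _
  have hb : (⌊(N : ℝ) * β + 1/2⌋ : ℝ) + fpart β N = N * β + 1/2 := Int.floor_add_fract _
  have hN : (N : ℝ) * α + N * β + N * γ = N := by rw [← mul_add, ← mul_add, hsum, mul_one]
  obtain ⟨hlo, hhi⟩ := betaShift_bounds (u := fpart α N) (v := fpart β N) hsum hβhalf hαγ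
    (Int.fract_nonneg _) (Int.fract_lt_one _) (Int.fract_nonneg _) (Int.fract_lt_one _)
  rw [hc]
  constructor <;> linarith

/-- The `n`-th element `c̃(n)` of `W̃_γ` differs from `c(n) = ⌈(n−1/2)/γ⌉`
by at most `1`. -/
theorem ctilde_close_to_c (α β γ : ℝ)
    (hα : 0 < α) (hβ : 0 < β) (hγ : 0 < γ)
    (hαi : Irrational α) (hβi : Irrational β) (hγi : Irrational γ)
    (hsum : α + β + γ = 1) (hβhalf : β < 1/2) (hαγ : α < γ) :
    ∀ n : ℕ, 1 ≤ n →
      (wTerm γ n : ℤ) - 1 ≤ (nthElt (WtC α β) n : ℤ) ∧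
      (nthElt (WtC α β) n : ℤ) ≤ (wTerm γ n : ℤ) + 1 := by
  classical
  intro n hn
  have hn' : (1 : ℝ) ≤ n := by exact_mod_cast hn
  have hcount := count_WtC_bounds hα hβ hαi hβi hsum hβhalf hαγ
  have hle : (n : ℝ) - 1/2 ≤ wTerm γ n * γ := (div_le_iff₀ hγ).1 (Nat.le_ceil _)
  have hlt : ((wTerm γ n : ℝ) - 1) * γ < n - 1/2 := by
    rw [← lt_div_iff₀ hγ, sub_lt_iff_lt_add]
    exact Nat.ceil_lt_add_one (div_nonneg (by linarith) hγ.le)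
  unfold nthElt
  generalize wTerm γ n = c at *
  have hupper : n - 1 < Nat.count (· ∈ WtC α β) (c + 1 + 1) := by
    have h := (hcount (c + 1)).1
    push_cast at h
    have : (n : ℝ) < (Nat.count (· ∈ WtC α β) (c + 1 + 1) : ℝ) + 1 := by linarith
    have : n < Nat.count (· ∈ WtC α β) (c + 1 + 1) + 1 := by exact_mod_cast this
    omega
  refine ⟨?_, by have := Nat.nth_lt_of_lt_count hupper; omega⟩
  by_contra! hcon
  obtain ⟨m, rfl⟩ : ∃ m, c = m + 2 := ⟨c - 2, by omega⟩
  have hlower : Nat.count (· ∈ WtC α β) (m + 1) < n := by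
    have h := (hcount m).2
    push_cast at hlt
    have : (Nat.count (· ∈ WtC α β) (m + 1) : ℝ) < n := by linarith
    exact_mod_cast this
  have hsucc : Nat.count (· ∈ WtC α β) (Nat.nth (· ∈ WtC α β) (n - 1) + 1) = n - 1 + 1 :=
    Nat.count_nth_succ fun hf => hupper.trans_le (Nat.count_le_card hf _)
  have hmono : Nat.count (· ∈ WtC α β) (Nat.nth (· ∈ WtC α β) (n - 1) + 1) ≤
      Nat.count (· ∈ WtC α β) (m + 1) := Nat.count_monotone _ (by omega)
  omega
end
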